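/- Fix 1 ≤ k ≤ d and 0 < δ < 1. Let 𝒜 be a nearly isometric random linear map from ℝ^{d×d} to ℝ^n, i.e., 𝔼‖𝒜(X)‖² = ‖X‖_{HS}² for all X, and for all 0 < ε < 1 and each fixed X: (1−ε)‖X‖_{HS}² ≤ ‖𝒜(X)‖² ≤ (1+ε)‖X‖_{HS}² with failure probability at most 2e^{−n f(ε)} for some increasing f : (0,1) → ℝ_{>0}. Define A(x) := 𝒜(xx*). Then, with probability at least 1 − 2 exp(−n(f(δ/2) − ((4k+2)/n)log(65/δ) − (2k/n)log(ed/(2k)))), simultaneously for all k-sparse x, y ∈ ℝ^d: (1−δ)‖xx* − yy*‖_{HS} ≤ ‖A(x) − A(y)‖₂ ≤ (1+δ)‖xx* − yy*‖_{HS}. -/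

import Mathlib

noncomputable section
open scoped BigOperators
open MeasureTheory

/-- A real vector is `k`-sparse if it has at most `k` nonzero entries. -/
def Sparse {d : ℕ} (k : ℕ) (y : EuclideanSpace ℝ (Fin d)) : Prop :=
  (Finset.univ.filter fun i => y i ≠ 0).card ≤ k

/-- The Hilbert–Schmidt (Frobenius) norm of a matrix. -/
def hsNorm {d : ℕ} (M : Matrix (Fin d) (Fin d) ℝ) : ℝ :=
  Real.sqrt (∑ i, ∑ j, (M i j) ^ 2)

/-- The outer product `x x*`. -/
def outer {d : ℕ} (x : EuclideanSpace ℝ (Fin d)) : Matrix (Fin d) (Fin d) ℝ :=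
  Matrix.of fun i j => x i * x j

/-! ### Nets in finite dimensional normed spaces -/

theorem card_separated_le {E : Type*} [NormedAddCommGroup E] [NormedSpace ℝ E]
    [FiniteDimensional ℝ E] {ε : ℝ} (hε : 0 < ε) (s : Finset E) (hs : ∀ c ∈ s, ‖c‖ ≤ 1)
    (h : ∀ c ∈ s, ∀ d ∈ s, c ≠ d → ε ≤ ‖c - d‖) :
    (s.card : ℝ) ≤ (1 + 2 / ε) ^ Module.finrank ℝ E := by
  borelize E
  let μ : Measure E := Measure.addHaar
  have hr : 0 < ε / 2 := by positivity
  have hρ : 0 < 1 + ε / 2 := by positivity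
  have D : Set.Pairwise (s : Set E) (Function.onFun Disjoint fun c => Metric.ball (c : E) (ε / 2)) := by
    rintro c hc d hd hcd
    apply Metric.ball_disjoint_ball
    rw [dist_eq_norm]
    have := h c hc d hd hcd
    linarith
  have A_subset : (⋃ c ∈ s, Metric.ball (c : E) (ε / 2)) ⊆ Metric.ball (0 : E) (1 + ε / 2) := by
    refine Set.iUnion₂_subset fun x hx => ?_
    apply Metric.ball_subset_ball'
    rw [dist_zero_right]
    have := hs x hx
    linarith
  have I : (s.card : ENNReal) * ENNReal.ofReal ((ε / 2) ^ Module.finrank ℝ E) * μ (Metric.ball 0 1) ≤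
      ENNReal.ofReal ((1 + ε / 2) ^ Module.finrank ℝ E) * μ (Metric.ball 0 1) :=
    calc
      _ = μ (⋃ c ∈ s, Metric.ball (c : E) (ε / 2)) := by
        rw [measure_biUnion_finset D fun c _ => measurableSet_ball]
        simp only [μ.addHaar_ball_of_pos _ hr]
        simp only [Finset.sum_const, nsmul_eq_mul, mul_assoc]
      _ ≤ μ (Metric.ball (0 : E) (1 + ε / 2)) := measure_mono A_subset
      _ = _ := by simp only [μ.addHaar_ball_of_pos _ hρ]
  have J : (s.card : ENNReal) * ENNReal.ofReal ((ε / 2) ^ Module.finrank ℝ E) ≤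
      ENNReal.ofReal ((1 + ε / 2) ^ Module.finrank ℝ E) :=
    (ENNReal.mul_le_mul_iff_left (Metric.measure_ball_pos _ _ zero_lt_one).ne'
      measure_ball_lt_top.ne).1 I
  have K := ENNReal.toReal_le_of_le_ofReal (pow_nonneg hρ.le _) J
  rw [ENNReal.toReal_mul, ENNReal.toReal_natCast, ENNReal.toReal_ofReal (by positivity)] at K
  have e : (1 + 2 / ε) = (1 + ε / 2) / (ε / 2) := by field_simp; ring
  rw [e, div_pow, le_div_iff₀ (by positivity)]
  exact K

theorem exists_net (E : Type*) [NormedAddCommGroup E] [NormedSpace ℝ E]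
    [FiniteDimensional ℝ E] {ε : ℝ} (hε : 0 < ε) :
    ∃ s : Finset E, (∀ c ∈ s, ‖c‖ ≤ 1) ∧ (∀ x : E, ‖x‖ ≤ 1 → ∃ c ∈ s, ‖x - c‖ ≤ ε) ∧
      (s.card : ℝ) ≤ (1 + 2 / ε) ^ Module.finrank ℝ E := by
  classical
  let Q : ℕ → Prop := fun m => ∃ s : Finset E, s.card = m ∧ (∀ c ∈ s, ‖c‖ ≤ 1) ∧
    (∀ c ∈ s, ∀ d ∈ s, c ≠ d → ε ≤ ‖c - d‖)
  have hQ0 : Q 0 := ⟨∅, by simp⟩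
  have hb : ∀ m, Q m → m ≤ ⌊(1 + 2 / ε) ^ Module.finrank ℝ E⌋₊ := by
    rintro m ⟨s, rfl, h1, h2⟩
    exact Nat.le_floor (card_separated_le hε s h1 h2)
  obtain ⟨s, hc, h1, h2⟩ := Nat.findGreatest_spec (P := Q) (Nat.zero_le ⌊(1 + 2 / ε) ^ Module.finrank ℝ E⌋₊) hQ0
  refine ⟨s, h1, ?_, card_separated_le hε s h1 h2⟩
  intro x hx
  by_contra! hcon
  have hxs : x ∉ s := fun hxs => by
    have := hcon x hxs
    simp at this
    linarith
  have hQ1 : Q (s.card + 1) := by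
    refine ⟨insert x s, Finset.card_insert_of_notMem hxs, ?_, ?_⟩
    · intro c hc
      rcases Finset.mem_insert.1 hc with rfl | hc
      · exact hx
      · exact h1 c hc
    · intro c hc d hd hcd
      rcases Finset.mem_insert.1 hc with rfl | hc'
      · rcases Finset.mem_insert.1 hd with rfl | hd
        · exact absurd rfl hcd
        · exact (hcon d hd).le
      · rcases Finset.mem_insert.1 hd with rfl | hd
        · rw [norm_sub_rev]; exact (hcon c hc').le
        · exact h2 c hc' d hd hcd
  have := Nat.le_findGreatest (P := Q) (hb _ hQ1) hQ1
  omega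

/-! ### The Hilbert-Schmidt norm -/

section Frob
open scoped Matrix.Norms.Frobenius

theorem hsNorm_eq_norm {d : ℕ} (M : Matrix (Fin d) (Fin d) ℝ) : hsNorm M = ‖M‖ := by
  rw [Matrix.frobenius_norm_def, hsNorm, Real.sqrt_eq_rpow]
  simp

theorem hsNorm_add_le {d : ℕ} (M N : Matrix (Fin d) (Fin d) ℝ) :
    hsNorm (M + N) ≤ hsNorm M + hsNorm N := by
  simp only [hsNorm_eq_norm]; exact norm_add_le M N

theorem hsNorm_smul {d : ℕ} (c : ℝ) (M : Matrix (Fin d) (Fin d) ℝ) :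
    hsNorm (c • M) = |c| * hsNorm M := by
  simp only [hsNorm_eq_norm]; rw [norm_smul, Real.norm_eq_abs]

theorem hsNorm_neg {d : ℕ} (M : Matrix (Fin d) (Fin d) ℝ) : hsNorm (-M) = hsNorm M := by
  simp only [hsNorm_eq_norm]; exact norm_neg M

theorem exists_hs_bound {d n : ℕ} (T : Matrix (Fin d) (Fin d) ℝ →ₗ[ℝ] EuclideanSpace ℝ (Fin n)) :
    ∃ C : ℝ, 0 ≤ C ∧ ∀ M, ‖T M‖ ≤ C * hsNorm M := by
  refine ⟨∑ i, ∑ j, ‖T (Matrix.single i j 1)‖, by positivity, fun M => ?_⟩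
  have hM : T M = ∑ i, ∑ j, M i j • T (Matrix.single i j 1) := by
    conv_lhs => rw [Matrix.matrix_eq_sum_single M]
    simp only [map_sum, ← map_smul, Matrix.smul_single, smul_eq_mul, mul_one]
  have hij : ∀ i j, |M i j| ≤ hsNorm M := by
    intro i j
    unfold hsNorm
    refine Real.abs_le_sqrt ?_
    refine le_trans ?_ (Finset.single_le_sum (f := fun i => ∑ j, M i j ^ 2)
      (fun i _ => Finset.sum_nonneg fun j _ => sq_nonneg _) (Finset.mem_univ i))
    exact Finset.single_le_sum (f := fun j => M i j ^ 2)
      (fun j _ => sq_nonneg _) (Finset.mem_univ j)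
  rw [hM, Finset.sum_mul]
  refine (norm_sum_le _ _).trans (Finset.sum_le_sum fun i _ => ?_)
  rw [Finset.sum_mul]
  refine (norm_sum_le _ _).trans (Finset.sum_le_sum fun j _ => ?_)
  rw [norm_smul, Real.norm_eq_abs, mul_comm]
  exact mul_le_mul_of_nonneg_left (hij i j) (norm_nonneg _)
end Frob

theorem hsNorm_nonneg {d : ℕ} (M : Matrix (Fin d) (Fin d) ℝ) : 0 ≤ hsNorm M := Real.sqrt_nonneg _

theorem hsNorm_sq {d : ℕ} (M : Matrix (Fin d) (Fin d) ℝ) :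
    hsNorm M ^ 2 = ∑ i, ∑ j, (M i j) ^ 2 := by
  unfold hsNorm
  exact Real.sq_sqrt (Finset.sum_nonneg fun i _ => Finset.sum_nonneg fun j _ => sq_nonneg _)

theorem le_of_sq_le_sq_aux {a b : ℝ} (h : a ^ 2 ≤ b ^ 2) (hb : 0 ≤ b) : a ≤ b :=
  (le_abs_self a).trans ((sq_le_sq.1 h).trans (abs_of_nonneg hb).le)

/-- The symmetrised product of two vectors. -/
def symProd {d : ℕ} (u v : EuclideanSpace ℝ (Fin d)) : Matrix (Fin d) (Fin d) ℝ :=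
  Matrix.of fun i j => (u i * v j + v i * u j) / 2

theorem outer_sub_outer {d : ℕ} (x y : EuclideanSpace ℝ (Fin d)) :
    outer x - outer y = symProd (x - y) (x + y) := by
  ext i j; simp [outer, symProd]; ring

theorem symProd_smul {d : ℕ} (a b : ℝ) (u v : EuclideanSpace ℝ (Fin d)) :
    symProd (a • u) (b • v) = (a * b) • symProd u v := by
  ext i j; simp [symProd]; ring

theorem symProd_split {d : ℕ} (u v p q : EuclideanSpace ℝ (Fin d)) :
    symProd u v = symProd p q + (symProd (u - p) v + symProd p (v - q)) := by
  ext i j; simp [symProd]; ring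

theorem hsNorm_symProd_sq {d : ℕ} (u v : EuclideanSpace ℝ (Fin d)) :
    hsNorm (symProd u v) ^ 2 = (‖u‖ ^ 2 * ‖v‖ ^ 2 + (inner ℝ u v) ^ 2) / 2 := by
  rw [hsNorm_sq]
  have e1 : ‖u‖ ^ 2 * ‖v‖ ^ 2 = ∑ i, ∑ j, (u i) ^ 2 * (v j) ^ 2 := by
    rw [EuclideanSpace.real_norm_sq_eq, EuclideanSpace.real_norm_sq_eq, Finset.sum_mul_sum]
  have e1' : ‖u‖ ^ 2 * ‖v‖ ^ 2 = ∑ i, ∑ j, (v i) ^ 2 * (u j) ^ 2 := by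
    rw [mul_comm, EuclideanSpace.real_norm_sq_eq, EuclideanSpace.real_norm_sq_eq, Finset.sum_mul_sum]
  have e2 : (inner ℝ u v : ℝ) ^ 2 = ∑ i, ∑ j, (u i * v i) * (u j * v j) := by
    have : (inner ℝ u v : ℝ) = ∑ i, u i * v i := by
      simp [PiLp.inner_apply, mul_comm]
    rw [this, sq, Finset.sum_mul_sum]
  have e3 : ∑ i, ∑ j, (symProd u v i j) ^ 2 =
      ((∑ i, ∑ j, (u i) ^ 2 * (v j) ^ 2) + (∑ i, ∑ j, (v i) ^ 2 * (u j) ^ 2)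
       + 2 * ∑ i, ∑ j, (u i * v i) * (u j * v j)) / 4 := by
    simp only [Finset.mul_sum, ← Finset.sum_add_distrib, Finset.sum_div]
    refine Finset.sum_congr rfl fun i _ => Finset.sum_congr rfl fun j _ => ?_
    simp [symProd]; ring
  rw [e3, ← e1, ← e1', ← e2]; ring

theorem hsNorm_symProd_le {d : ℕ} (u v : EuclideanSpace ℝ (Fin d)) :
    hsNorm (symProd u v) ≤ ‖u‖ * ‖v‖ := by
  refine le_of_sq_le_sq_aux ?_ (by positivity)
  rw [hsNorm_symProd_sq]
  have := abs_real_inner_le_norm u v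
  have h2 := pow_le_pow_left₀ (abs_nonneg _) this 2
  rw [sq_abs] at h2
  nlinarith

theorem le_hsNorm_symProd {d : ℕ} (u v : EuclideanSpace ℝ (Fin d)) (hu : ‖u‖ = 1) (hv : ‖v‖ = 1) :
    1 / 2 ≤ hsNorm (symProd u v) := by
  refine le_of_sq_le_sq_aux ?_ (hsNorm_nonneg _)
  rw [hsNorm_symProd_sq, hu, hv]
  nlinarith [sq_nonneg (inner ℝ u v : ℝ)]

/-! ### The deterministic step -/

theorem symProd_zero_left {d : ℕ} (v : EuclideanSpace ℝ (Fin d)) : symProd 0 v = 0 := by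
  ext i j; simp [symProd]
theorem symProd_zero_right {d : ℕ} (v : EuclideanSpace ℝ (Fin d)) : symProd v 0 = 0 := by
  ext i j; simp [symProd]
theorem hsNorm_zero {d : ℕ} : hsNorm (0 : Matrix (Fin d) (Fin d) ℝ) = 0 := by
  simp [hsNorm]

/-- Approximation by net elements, for unit vectors. -/
theorem approx_step {d n : ℕ} {δ : ℝ} (hδ0 : 0 < δ) (hδ1 : δ < 1)
    (T : Matrix (Fin d) (Fin d) ℝ →ₗ[ℝ] EuclideanSpace ℝ (Fin n))
    (V : Submodule ℝ (EuclideanSpace ℝ (Fin d))) (N : Finset V)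
    (hN1 : ∀ c ∈ N, ‖c‖ ≤ 1) (hN : ∀ x : V, ‖x‖ ≤ 1 → ∃ c ∈ N, ‖x - c‖ ≤ δ / 32)
    (hT : ∀ p ∈ N, ∀ q ∈ N,
      (1 - δ / 2) * hsNorm (symProd (p : EuclideanSpace ℝ (Fin d)) (q : EuclideanSpace ℝ (Fin d))) ^ 2 ≤ ‖T (symProd (p : EuclideanSpace ℝ (Fin d)) (q : EuclideanSpace ℝ (Fin d)))‖ ^ 2 ∧
      ‖T (symProd (p : EuclideanSpace ℝ (Fin d)) (q : EuclideanSpace ℝ (Fin d)))‖ ^ 2 ≤ (1 + δ / 2) * hsNorm (symProd (p : EuclideanSpace ℝ (Fin d)) (q : EuclideanSpace ℝ (Fin d))) ^ 2)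
    {C : ℝ} (hC0 : 0 ≤ C)
    (hC : ∀ u ∈ V, ∀ v ∈ V, ‖T (symProd u v)‖ ≤ C * hsNorm (symProd u v))
    (u v : EuclideanSpace ℝ (Fin d)) (huV : u ∈ V) (hvV : v ∈ V) :
    ‖T (symProd u v)‖ ≤ ((1 + δ / 4) * (1 + δ / 8) + C * (δ / 8)) * hsNorm (symProd u v) ∧
    ((1 - δ / 2) * (1 - δ / 8) - C * (δ / 8)) * hsNorm (symProd u v) ≤ ‖T (symProd u v)‖ := by
  -- reduction to unit vectors
  suffices H : ∀ u ∈ V, ∀ v ∈ V, ‖u‖ = 1 → ‖v‖ = 1 →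
      ‖T (symProd u v)‖ ≤ ((1 + δ / 4) * (1 + δ / 8) + C * (δ / 8)) * hsNorm (symProd u v) ∧
      ((1 - δ / 2) * (1 - δ / 8) - C * (δ / 8)) * hsNorm (symProd u v) ≤ ‖T (symProd u v)‖ by
    by_cases hu : u = 0
    · subst hu; simp [symProd_zero_left, hsNorm_zero]
    by_cases hv : v = 0
    · subst hv; simp [symProd_zero_right, hsNorm_zero]
    have hu' : 0 < ‖u‖ := norm_pos_iff.2 hu
    have hv' : 0 < ‖v‖ := norm_pos_iff.2 hv
    have key := H (‖u‖⁻¹ • u) (V.smul_mem _ huV) (‖v‖⁻¹ • v) (V.smul_mem _ hvV)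
      (norm_smul_inv_norm hu) (norm_smul_inv_norm hv)
    have e : symProd u v = (‖u‖ * ‖v‖) • symProd (‖u‖⁻¹ • u) (‖v‖⁻¹ • v) := by
      rw [symProd_smul, smul_smul]
      field_simp
      simp
    have hpos : 0 < ‖u‖ * ‖v‖ := by positivity
    rw [e, map_smul, norm_smul, hsNorm_smul, Real.norm_eq_abs, abs_of_pos hpos]
    constructor
    · nlinarith [mul_le_mul_of_nonneg_left key.1 hpos.le]
    · nlinarith [mul_le_mul_of_nonneg_left key.2 hpos.le]
  clear huV hvV u v
  intro u huV v hvV hu hv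
  obtain ⟨p, hp, hup⟩ := hN ⟨u, huV⟩ hu.le
  obtain ⟨q, hq, hvq⟩ := hN ⟨v, hvV⟩ hv.le
  have hup' : ‖u - (p : EuclideanSpace ℝ (Fin d))‖ ≤ δ / 32 := hup
  have hvq' : ‖v - (q : EuclideanSpace ℝ (Fin d))‖ ≤ δ / 32 := hvq
  have hp1 : ‖(p : EuclideanSpace ℝ (Fin d))‖ ≤ 1 := hN1 p hp
  obtain ⟨hT1, hT2⟩ := hT p hp q hq
  have hs := le_hsNorm_symProd u v hu hv
  have a1 : hsNorm (symProd (u - (p : EuclideanSpace ℝ (Fin d))) v) ≤ δ / 32 := by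
    refine (hsNorm_symProd_le _ _).trans ?_
    rw [hv]; linarith
  have a2 : hsNorm (symProd (p : EuclideanSpace ℝ (Fin d)) (v - q)) ≤ δ / 32 := by
    refine (hsNorm_symProd_le _ _).trans ?_
    nlinarith [norm_nonneg (p : EuclideanSpace ℝ (Fin d)), norm_nonneg (v - (q : EuclideanSpace ℝ (Fin d)))]
  have b1 := hC (u - p) (V.sub_mem huV p.2) v hvV
  have b2 := hC p p.2 (v - q) (V.sub_mem hvV q.2)
  have e := symProd_split u v p q
  set W := symProd (u - (p : EuclideanSpace ℝ (Fin d))) v + symProd (p : EuclideanSpace ℝ (Fin d)) (v - q) with hW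
  set X0 := symProd (p : EuclideanSpace ℝ (Fin d)) q with hX0
  set X := symProd u v with hX
  have w1 : hsNorm W ≤ δ / 16 := (hsNorm_add_le _ _).trans (by linarith)
  have w2 : ‖T W‖ ≤ C * (δ / 16) := by
    rw [hW, map_add]
    refine (norm_add_le _ _).trans ?_
    have := mul_le_mul_of_nonneg_left a1 hC0
    have := mul_le_mul_of_nonneg_left a2 hC0
    linarith
  have c1 : hsNorm X0 ≤ hsNorm X + hsNorm W := by
    have : X0 = X + -W := by rw [e]; abel
    rw [this, ← hsNorm_neg W]; exact hsNorm_add_le _ _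
  have c2 : hsNorm X ≤ hsNorm X0 + hsNorm W := by
    rw [e]; exact hsNorm_add_le _ _
  have d1 : ‖T X‖ ≤ ‖T X0‖ + ‖T W‖ := by
    rw [e, map_add]; exact norm_add_le _ _
  have d2 : ‖T X0‖ ≤ ‖T X‖ + ‖T W‖ := by
    have : T X0 = T X - T W := by rw [e, map_add]; abel
    rw [this]; exact norm_sub_le _ _
  have h0 := hsNorm_nonneg X0
  have f1 : ‖T X0‖ ≤ (1 + δ / 4) * hsNorm X0 := by
    refine le_of_sq_le_sq_aux ?_ (by positivity)
    rw [mul_pow]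
    nlinarith [sq_nonneg (hsNorm X0), sq_nonneg δ]
  have f2 : (1 - δ / 2) * hsNorm X0 ≤ ‖T X0‖ := by
    refine le_of_sq_le_sq_aux ?_ (norm_nonneg _)
    rw [mul_pow]
    refine le_trans ?_ hT1
    refine mul_le_mul_of_nonneg_right ?_ (sq_nonneg _)
    nlinarith
  have g : δ / 16 ≤ δ / 8 * hsNorm X := by nlinarith
  have g2 : ‖T W‖ ≤ C * (δ / 8) * hsNorm X := by
    have := mul_le_mul_of_nonneg_left g hC0
    linarith
  constructor
  · have : hsNorm X0 ≤ (1 + δ / 8) * hsNorm X := by linarith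
    have := mul_le_mul_of_nonneg_left this (show 0 ≤ 1 + δ / 4 by linarith)
    linarith
  · have : (1 - δ / 8) * hsNorm X ≤ hsNorm X0 := by linarith
    have := mul_le_mul_of_nonneg_left this (show 0 ≤ 1 - δ / 2 by linarith)
    linarith

theorem det_step {d n : ℕ} {δ : ℝ} (hδ0 : 0 < δ) (hδ1 : δ < 1)
    (T : Matrix (Fin d) (Fin d) ℝ →ₗ[ℝ] EuclideanSpace ℝ (Fin n))
    (V : Submodule ℝ (EuclideanSpace ℝ (Fin d))) (N : Finset V)
    (hN1 : ∀ c ∈ N, ‖c‖ ≤ 1) (hN : ∀ x : V, ‖x‖ ≤ 1 → ∃ c ∈ N, ‖x - c‖ ≤ δ / 32)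
    (hT : ∀ p ∈ N, ∀ q ∈ N,
      (1 - δ / 2) * hsNorm (symProd (p : EuclideanSpace ℝ (Fin d)) (q : EuclideanSpace ℝ (Fin d))) ^ 2 ≤ ‖T (symProd (p : EuclideanSpace ℝ (Fin d)) (q : EuclideanSpace ℝ (Fin d)))‖ ^ 2 ∧
      ‖T (symProd (p : EuclideanSpace ℝ (Fin d)) (q : EuclideanSpace ℝ (Fin d)))‖ ^ 2 ≤ (1 + δ / 2) * hsNorm (symProd (p : EuclideanSpace ℝ (Fin d)) (q : EuclideanSpace ℝ (Fin d))) ^ 2)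
    (u v : EuclideanSpace ℝ (Fin d)) (huV : u ∈ V) (hvV : v ∈ V) :
    (1 - δ) * hsNorm (symProd u v) ≤ ‖T (symProd u v)‖ ∧
    ‖T (symProd u v)‖ ≤ (1 + δ) * hsNorm (symProd u v) := by
  let K : Set ℝ := {C | 0 ≤ C ∧ ∀ u ∈ V, ∀ v ∈ V, ‖T (symProd u v)‖ ≤ C * hsNorm (symProd u v)}
  have hne : K.Nonempty := by
    obtain ⟨C, h0, hC⟩ := exists_hs_bound T
    exact ⟨C, h0, fun u _ v _ => hC _⟩
  have hbd : BddBelow K := ⟨0, fun C hC => hC.1⟩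
  have hcl : IsClosed K := by
    have : K = Set.Ici 0 ∩ ⋂ u ∈ V, ⋂ v ∈ V,
        {C : ℝ | ‖T (symProd u v)‖ ≤ C * hsNorm (symProd u v)} := by
      ext C; simp [K]
    rw [this]
    refine isClosed_Ici.inter ?_
    refine isClosed_biInter fun u _ => isClosed_biInter fun v _ => ?_
    exact isClosed_le continuous_const (by fun_prop)
  have hmem := hcl.csInf_mem hne hbd
  set C := sInf K with hCdef
  have hmem' : (1 + δ / 4) * (1 + δ / 8) + C * (δ / 8) ∈ K := by
    refine ⟨?_, fun u hu v hv =>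
      (approx_step hδ0 hδ1 T V N hN1 hN hT hmem.1 hmem.2 u v hu hv).1⟩
    have := hmem.1
    positivity
  have hle : C ≤ (1 + δ / 4) * (1 + δ / 8) + C * (δ / 8) := csInf_le hbd hmem'
  have hC1 : C ≤ 1 + δ := by
    by_contra! hcon
    nlinarith
  have hs := hsNorm_nonneg (symProd u v)
  constructor
  · refine le_trans (mul_le_mul_of_nonneg_right ?_ hs)
      (approx_step hδ0 hδ1 T V N hN1 hN hT hmem.1 hmem.2 u v huV hvV).2
    nlinarith
  · exact (hmem.2 u huV v hvV).trans (mul_le_mul_of_nonneg_right hC1 hs)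

/-! ### Coordinate subspaces -/

/-- Vectors supported in `S`. -/
def coordSub {d : ℕ} (S : Finset (Fin d)) : Submodule ℝ (EuclideanSpace ℝ (Fin d)) where
  carrier := {x | ∀ i, i ∉ S → x i = 0}
  add_mem' := by
    intro a b ha hb i hi
    simp [ha i hi, hb i hi]
  zero_mem' := by intro i _; simp
  smul_mem' := by
    intro c x hx i hi
    simp [hx i hi]

theorem finrank_coordSub {d : ℕ} (S : Finset (Fin d)) :
    Module.finrank ℝ (coordSub S) ≤ S.card := by
  let L : coordSub S →ₗ[ℝ] (S → ℝ) :=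
    { toFun := fun x i => (x : EuclideanSpace ℝ (Fin d)) i
      map_add' := by intro x y; ext i; simp
      map_smul' := by intro c x; ext i; simp }
  have hL : Function.Injective L := by
    intro x y hxy
    ext i
    by_cases hi : i ∈ S
    · exact congrFun hxy ⟨i, hi⟩
    · rw [x.2 i hi, y.2 i hi]
  have := LinearMap.finrank_le_finrank_of_injective hL
  simpa using this

theorem exists_support {d k : ℕ} (x y : EuclideanSpace ℝ (Fin d)) (hx : Sparse k x)
    (hy : Sparse k y) : ∃ S ∈ Finset.powersetCard (min (2 * k) d) (Finset.univ : Finset (Fin d)),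
      x ∈ coordSub S ∧ y ∈ coordSub S := by
  classical
  set A := (Finset.univ.filter fun i => x i ≠ 0) ∪ (Finset.univ.filter fun i => y i ≠ 0) with hA
  have hAc : A.card ≤ min (2 * k) d := by
    refine le_min ?_ ?_
    · refine (Finset.card_union_le _ _).trans ?_
      unfold Sparse at hx hy
      omega
    · simpa using Finset.card_le_univ A
  obtain ⟨S, hAS, hS⟩ := Finset.exists_superset_card_eq hAc (by simp)
  refine ⟨S, by simp [Finset.mem_powersetCard, hS], ?_, ?_⟩
  · intro i hi
    by_contra h
    exact hi (hAS (by simp [hA, h]))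
  · intro i hi
    by_contra h
    exact hi (hAS (by simp [hA, h]))

theorem choose_bound {d k : ℕ} (hk1 : 1 ≤ k) (hkd : k ≤ d) :
    ((d.choose (min (2 * k) d) : ℕ) : ℝ) ≤ (Real.exp 1 * d / (2 * k)) ^ (2 * k) := by
  have hk : (0 : ℝ) < k := by exact_mod_cast hk1
  have hd : (0 : ℝ) < d := by exact_mod_cast (lt_of_lt_of_le hk1 hkd)
  rcases le_total (2 * k) d with h | h
  · rw [min_eq_left h]
    refine (Nat.choose_le_pow_div (α := ℝ) (2 * k) d).trans ?_
    have h1 := Real.pow_div_factorial_le_exp (x := ((2 * k : ℕ) : ℝ)) (by positivity) (2 * k)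
    have hf : (0 : ℝ) < ((2 * k).factorial : ℝ) := by exact_mod_cast Nat.factorial_pos _
    rw [div_le_iff₀ hf] at h1 ⊢
    rw [div_pow, mul_pow, ← Real.exp_nat_mul, mul_one, div_mul_eq_mul_div,
      le_div_iff₀ (by positivity)]
    push_cast at h1 ⊢
    have hp : (0 : ℝ) ≤ (d : ℝ) ^ (2 * k) := by positivity
    nlinarith [mul_le_mul_of_nonneg_left h1 hp]
  · rw [min_eq_right h, Nat.choose_self]
    push_cast
    refine one_le_pow₀ ?_
    rw [le_div_iff₀ (by positivity)]
    have he : (2 : ℝ) ≤ Real.exp 1 := by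
      have := Real.add_one_le_exp (1 : ℝ); linarith
    have : (k : ℝ) ≤ d := by exact_mod_cast hkd
    nlinarith

/-- Theorem 3.16 of the paper: if `𝒜` is a nearly isometric random linear map from
`ℝ^{d×d}` to `ℝ^n` and `A(x) := 𝒜(xx*)`, then with probability of failure at most
`2 exp(−n(f(δ/2) − ((4k+2)/n)log(65/δ) − (2k/n)log(ed/(2k))))`, uniformly for all
`k`-sparse `x, y ∈ ℝ^d`:
`(1−δ)‖xx* − yy*‖_HS ≤ ‖A(x) − A(y)‖ ≤ (1+δ)‖xx* − yy*‖_HS`. -/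
theorem nearly_isometric_sparse_rip
    {d n k : ℕ} (hk1 : 1 ≤ k) (hkd : k ≤ d) (δ : ℝ) (hδ0 : 0 < δ) (hδ1 : δ < 1)
    {Ω : Type} [MeasurableSpace Ω] (P : Measure Ω) [IsProbabilityMeasure P]
    (𝒜 : Ω → (Matrix (Fin d) (Fin d) ℝ →ₗ[ℝ] EuclideanSpace ℝ (Fin n)))
    (f : ℝ → ℝ) (hf_pos : ∀ ε : ℝ, 0 < ε → ε < 1 → 0 < f ε)
    (hf_mono : ∀ ε ε' : ℝ, 0 < ε → ε < ε' → ε' < 1 → f ε ≤ f ε')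
    -- nearly isometric: second moment identity
    (hiso : ∀ X : Matrix (Fin d) (Fin d) ℝ, ∫ ω, ‖𝒜 ω X‖ ^ 2 ∂P = hsNorm X ^ 2)
    -- nearly isometric: concentration for each fixed matrix
    (hconc : ∀ ε : ℝ, 0 < ε → ε < 1 → ∀ X : Matrix (Fin d) (Fin d) ℝ,
      P {ω | ¬ ((1 - ε) * hsNorm X ^ 2 ≤ ‖𝒜 ω X‖ ^ 2 ∧
                ‖𝒜 ω X‖ ^ 2 ≤ (1 + ε) * hsNorm X ^ 2)}
        ≤ ENNReal.ofReal (2 * Real.exp (-(n : ℝ) * f ε))) :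
    P {ω | ¬ ∀ x y : EuclideanSpace ℝ (Fin d), Sparse k x → Sparse k y →
        (1 - δ) * hsNorm (outer x - outer y) ≤ ‖𝒜 ω (outer x - outer y)‖ ∧
        ‖𝒜 ω (outer x - outer y)‖ ≤ (1 + δ) * hsNorm (outer x - outer y)}
      ≤ ENNReal.ofReal (2 * Real.exp (-(n : ℝ) *
          (f (δ / 2) - ((4 * k + 2) / n) * Real.log (65 / δ)
            - (2 * k / n) * Real.log (Real.exp 1 * d / (2 * k))))) := by
  classical
  rcases Nat.eq_zero_or_pos n with hn | hn
  · subst hn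
    refine prob_le_one.trans ?_
    simp
  have hn' : (0 : ℝ) < n := by exact_mod_cast hn
  have hk : (0 : ℝ) < k := by exact_mod_cast hk1
  have hd : (0 : ℝ) < d := by exact_mod_cast (lt_of_lt_of_le hk1 hkd)
  choose N hN1 hN hNc using fun S : Finset (Fin d) =>
    exists_net (coordSub S) (ε := δ / 32) (by positivity)
  set 𝒮 := Finset.powersetCard (min (2 * k) d) (Finset.univ : Finset (Fin d)) with h𝒮
  let bad : Matrix (Fin d) (Fin d) ℝ → Set Ω := fun X =>
    {ω | ¬ ((1 - δ / 2) * hsNorm X ^ 2 ≤ ‖𝒜 ω X‖ ^ 2 ∧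
                ‖𝒜 ω X‖ ^ 2 ≤ (1 + δ / 2) * hsNorm X ^ 2)}
  have hsub : {ω | ¬ ∀ x y : EuclideanSpace ℝ (Fin d), Sparse k x → Sparse k y →
        (1 - δ) * hsNorm (outer x - outer y) ≤ ‖𝒜 ω (outer x - outer y)‖ ∧
        ‖𝒜 ω (outer x - outer y)‖ ≤ (1 + δ) * hsNorm (outer x - outer y)} ⊆
      ⋃ S ∈ 𝒮, ⋃ pq ∈ N S ×ˢ N S, bad (symProd (pq.1 : EuclideanSpace ℝ (Fin d)) (pq.2 : EuclideanSpace ℝ (Fin d))) := by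
    intro ω hω
    by_contra hcon
    apply hω
    intro x y hx hy
    obtain ⟨S, hS, hxS, hyS⟩ := exists_support x y hx hy
    rw [outer_sub_outer]
    refine det_step hδ0 hδ1 (𝒜 ω) (coordSub S) (N S) (hN1 S) (hN S) ?_ _ _
      ((coordSub S).sub_mem hxS hyS) ((coordSub S).add_mem hxS hyS)
    intro p hp q hq
    by_contra hb
    apply hcon
    simp only [Set.mem_iUnion]
    exact ⟨S, hS, (p, q), Finset.mem_product.2 ⟨hp, hq⟩, hb⟩
  have h65 : (1 : ℝ) ≤ 65 / δ := by rw [le_div_iff₀ hδ0]; linarith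
  have hcardN : ∀ S ∈ 𝒮, ((N S).card : ℝ) ≤ (65 / δ) ^ (2 * k) := by
    intro S hS
    have hSc : S.card ≤ 2 * k := by
      rw [(Finset.mem_powersetCard.1 hS).2]; exact min_le_left _ _
    refine (hNc S).trans ?_
    have h1 : 1 + 2 / (δ / 32) ≤ 65 / δ := by
      rw [le_div_iff₀ hδ0]; field_simp; linarith
    exact (pow_le_pow_left₀ (by positivity) h1 _).trans
      (pow_le_pow_right₀ h65 ((finrank_coordSub S).trans hSc))
  set β := 2 * Real.exp (-(n : ℝ) * f (δ / 2)) with hβ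
  have hβ0 : 0 ≤ β := by positivity
  have hbadP : ∀ X, P (bad X) ≤ ENNReal.ofReal β :=
    fun X => hconc (δ / 2) (by positivity) (by linarith) X
  refine (measure_mono hsub).trans ?_
  have step : P (⋃ S ∈ 𝒮, ⋃ pq ∈ N S ×ˢ N S, bad (symProd (pq.1 : EuclideanSpace ℝ (Fin d)) (pq.2 : EuclideanSpace ℝ (Fin d))))
      ≤ ENNReal.ofReal (∑ S ∈ 𝒮, ∑ pq ∈ N S ×ˢ N S, β) := by
    rw [ENNReal.ofReal_sum_of_nonneg fun S _ => Finset.sum_nonneg fun _ _ => hβ0]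
    refine (measure_biUnion_finset_le _ _).trans (Finset.sum_le_sum fun S _ => ?_)
    rw [ENNReal.ofReal_sum_of_nonneg fun _ _ => hβ0]
    exact (measure_biUnion_finset_le _ _).trans (Finset.sum_le_sum fun _ _ => hbadP _)
  refine step.trans (ENNReal.ofReal_le_ofReal ?_)
  have hsum : ∑ S ∈ 𝒮, ∑ pq ∈ N S ×ˢ N S, β ≤
      (Real.exp 1 * d / (2 * k)) ^ (2 * k) * ((65 / δ) ^ (4 * k + 2) * β) := by
    have h1 : ∀ S ∈ 𝒮, ∑ pq ∈ N S ×ˢ N S, β ≤ (65 / δ) ^ (4 * k + 2) * β := by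
      intro S hS
      rw [Finset.sum_const, nsmul_eq_mul, Finset.card_product]
      refine mul_le_mul_of_nonneg_right ?_ hβ0
      push_cast
      have h2 := hcardN S hS
      calc ((N S).card : ℝ) * (N S).card ≤ (65 / δ) ^ (2 * k) * (65 / δ) ^ (2 * k) := by gcongr
        _ = (65 / δ) ^ (4 * k) := by rw [← pow_add]; congr 1; ring
        _ ≤ _ := pow_le_pow_right₀ h65 (by omega)
    refine (Finset.sum_le_sum h1).trans ?_
    rw [Finset.sum_const, nsmul_eq_mul, h𝒮, Finset.card_powersetCard, Finset.card_univ,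
      Fintype.card_fin]
    exact mul_le_mul_of_nonneg_right (choose_bound hk1 hkd) (by positivity)
  refine hsum.trans (le_of_eq ?_)
  have e1 : (65 / δ) ^ (4 * k + 2) = Real.exp ((4 * k + 2) * Real.log (65 / δ)) := by
    have : ((4 * k + 2 : ℕ) : ℝ) = 4 * k + 2 := by push_cast; ring
    rw [← this, Real.exp_nat_mul, Real.exp_log (by positivity)]
  have e2 : (Real.exp 1 * d / (2 * k)) ^ (2 * k) =
      Real.exp ((2 * k) * Real.log (Real.exp 1 * d / (2 * k))) := by
    have : ((2 * k : ℕ) : ℝ) = 2 * k := by push_cast; ring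
    rw [← this, Real.exp_nat_mul, Real.exp_log (by rw [this]; positivity)]
  rw [e1, e2, hβ]
  have e3 : -(n : ℝ) * (f (δ / 2) - ((4 * k + 2) / n) * Real.log (65 / δ)
            - (2 * k / n) * Real.log (Real.exp 1 * d / (2 * k))) =
      (2 * k) * Real.log (Real.exp 1 * d / (2 * k)) + ((4 * k + 2) * Real.log (65 / δ)
        + -(n : ℝ) * f (δ / 2)) := by
    field_simp
    ring
  rw [e3, Real.exp_add, Real.exp_add]
  ring
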